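/- Let L_m^+ denote the set of m×m real lower triangular matrices with strictly positive diagonal entries. For L ∈ L_m^+ let ⌊L⌋ denote its strictly lower triangular part and D(L) its diagonal part, and define the Log-Cholesky distance d_LC(L_1, L_2) = (‖⌊L_1⌋ − ⌊L_2⌋‖_F² + ‖log D(L_1) − log D(L_2)‖_F²)^{1/2}, where log is applied entrywise to the diagonal. Let U_1, …, U_{J+1}, μ_t ∈ L_m^+ and α_t ∈ (0,1), and define g_t(U) ∈ L_m^+ by ⌊g_t(U)⌋ = ⌊μ_t⌋ + α_t(⌊U⌋ − ⌊μ_t⌋) and log D(g_t(U)) = log D(μ_t) + α_t(log D(U) − log D(μ_t)). For w ∈ Δ^{J-1} let M_w ∈ L_m^+ be the matrix with ⌊M_w⌋ = Σ_{j=2}^{J+1} w_j ⌊U_j⌋ and log D(M_w) = Σ_{j=2}^{J+1} w_j log D(U_j). Then: (i) g_t(M_w) is the unique minimizer over ν ∈ L_m^+ of Σ_{j=2}^{J+1} w_j d_LC²(ν, g_t(U_j)); (ii) d_LC(g_t(U_1), g_t(M_w)) = α_t d_LC(U_1, M_w); and consequently (iii) for every t, {w ∈ Δ^{J-1} : d_LC(g_t(U_1),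 g_t(M_w)) = 0} = {w ∈ Δ^{J-1} : d_LC(U_1, M_w) = 0}, a set not depending on t. -/

import Mathlib

noncomputable section

/-- The Frobenius norm of a real square matrix. -/
def frobNorm {m : ℕ} (A : Matrix (Fin m) (Fin m) ℝ) : ℝ :=
  Real.sqrt (∑ i, ∑ j, (A i j) ^ 2)

/-- `L_m^+`: the set of `m × m` real lower triangular matrices with strictly positive diagonal
entries. -/
def LowerPos (m : ℕ) : Set (Matrix (Fin m) (Fin m) ℝ) :=
  {L | (∀ i j : Fin m, i < j → L i j = 0) ∧ ∀ i, 0 < L i i}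

/-- The strictly lower triangular part `⌊L⌋` of a matrix. -/
def strictLower {m : ℕ} (L : Matrix (Fin m) (Fin m) ℝ) : Matrix (Fin m) (Fin m) ℝ :=
  fun i j => if j < i then L i j else 0

/-- The entrywise logarithm `log D(L)` of the diagonal part of a matrix. -/
def logDiag {m : ℕ} (L : Matrix (Fin m) (Fin m) ℝ) : Matrix (Fin m) (Fin m) ℝ :=
  Matrix.diagonal fun i => Real.log (L i i)

/-- The Log-Cholesky distance
`d_LC(L₁,L₂) = (‖⌊L₁⌋ − ⌊L₂⌋‖_F² + ‖log D(L₁) − log D(L₂)‖_F²)^{1/2}`. -/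
def dLC {m : ℕ} (L₁ L₂ : Matrix (Fin m) (Fin m) ℝ) : ℝ :=
  Real.sqrt (frobNorm (strictLower L₁ - strictLower L₂) ^ 2
    + frobNorm (logDiag L₁ - logDiag L₂) ^ 2)

/-- Log-Cholesky coordinates. -/
def phiLC {m : ℕ} (L : Matrix (Fin m) (Fin m) ℝ) (i j : Fin m) : ℝ :=
  strictLower L i j + logDiag L i j

theorem dLC_sq {m : ℕ} (A B : Matrix (Fin m) (Fin m) ℝ) :
    dLC A B ^ 2 = ∑ i, ∑ j, (phiLC A i j - phiLC B i j) ^ 2 := by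
  unfold dLC frobNorm
  rw [Real.sq_sqrt (by positivity), Real.sq_sqrt (by positivity), Real.sq_sqrt (by positivity)]
  rw [← Finset.sum_add_distrib]
  refine Finset.sum_congr rfl fun i _ => ?_
  rw [← Finset.sum_add_distrib]
  refine Finset.sum_congr rfl fun j _ => ?_
  simp only [phiLC, Matrix.sub_apply, strictLower, logDiag]
  by_cases h : j < i
  · simp [h, Matrix.diagonal_apply_ne _ h.ne']
  · simp [h]

theorem dLC_nonneg {m : ℕ} (A B : Matrix (Fin m) (Fin m) ℝ) : 0 ≤ dLC A B :=
  Real.sqrt_nonneg _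

theorem eq_of_dLC_sq {m : ℕ} {A B : Matrix (Fin m) (Fin m) ℝ} (hA : A ∈ LowerPos m)
    (hB : B ∈ LowerPos m) (h : dLC A B ^ 2 ≤ 0) : A = B := by
  have h0 : ∑ i, ∑ j, (phiLC A i j - phiLC B i j) ^ 2 = 0 := by
    rw [← dLC_sq]; exact le_antisymm h (sq_nonneg _)
  have h1 : ∀ i j, phiLC A i j = phiLC B i j := by
    intro i j
    rw [Finset.sum_eq_zero_iff_of_nonneg (fun i _ => by positivity)] at h0
    have h2 := h0 i (Finset.mem_univ i)
    rw [Finset.sum_eq_zero_iff_of_nonneg (fun i _ => by positivity)] at h2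
    have h3 := h2 j (Finset.mem_univ j)
    exact sub_eq_zero.mp (pow_eq_zero_iff two_ne_zero |>.mp h3)
  ext i j
  have h2 := h1 i j
  simp only [phiLC, strictLower, logDiag] at h2
  rcases lt_trichotomy i j with hij | hij | hij
  · rw [hA.1 i j hij, hB.1 i j hij]
  · subst hij
    simp at h2
    exact Real.log_injOn_pos (hA.2 i) (hB.2 i) h2
  · simpa [hij, Matrix.diagonal_apply_ne _ hij.ne'] using h2

theorem variance_id {J : ℕ} (w a : Fin J → ℝ) (hw : ∑ j, w j = 1) (c x : ℝ)
    (hc : c = ∑ j, w j * a j) :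
    ∑ j, w j * (x - a j) ^ 2 = ∑ j, w j * (c - a j) ^ 2 + (x - c) ^ 2 := by
  have h1 : ∀ y : ℝ, ∑ j, w j * (y - a j) ^ 2
      = y ^ 2 - 2 * y * c + ∑ j, w j * a j ^ 2 := by
    intro y
    have : ∀ j, w j * (y - a j) ^ 2
        = y ^ 2 * w j - 2 * y * (w j * a j) + w j * a j ^ 2 := fun j => by ring
    simp only [this, Finset.sum_add_distrib, Finset.sum_sub_distrib, ← Finset.mul_sum, hw, ← hc]
    ring
  rw [h1, h1]; ring

theorem dLC_variance {m J : ℕ} (w : Fin J → ℝ) (hw : ∑ j, w j = 1)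
    (V : Fin J → Matrix (Fin m) (Fin m) ℝ) (C N : Matrix (Fin m) (Fin m) ℝ)
    (hC : ∀ i k, phiLC C i k = ∑ j, w j * phiLC (V j) i k) :
    ∑ j, w j * dLC N (V j) ^ 2 = ∑ j, w j * dLC C (V j) ^ 2 + dLC N C ^ 2 := by
  have h1 : ∀ X : Matrix (Fin m) (Fin m) ℝ, ∑ j, w j * dLC X (V j) ^ 2
      = ∑ i, ∑ k, ∑ j, w j * (phiLC X i k - phiLC (V j) i k) ^ 2 := by
    intro X
    simp only [dLC_sq, Finset.mul_sum]
    rw [Finset.sum_comm]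
    refine Finset.sum_congr rfl fun i _ => ?_
    rw [Finset.sum_comm]
  rw [h1, h1, dLC_sq]
  simp only [← Finset.sum_add_distrib]
  refine Finset.sum_congr rfl fun i _ => Finset.sum_congr rfl fun k _ => ?_
  exact variance_id w _ hw _ _ (hC i k)

/-- Supplement Section S.4.3: verification of the perfect-fit Assumption 3.1
for the geodesic model under the Log-Cholesky metric on Cholesky factors.  With `g t U ∈ L_m^+`
defined by `⌊g t U⌋ = ⌊μ t⌋ + α t (⌊U⌋ − ⌊μ t⌋)` and
`log D(g t U) = log D(μ t) + α t (log D(U) − log D(μ t))`, and `M_w ∈ L_m^+` defined by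
`⌊M_w⌋ = ∑ j, w j ⌊U j⌋` and `log D(M_w) = ∑ j, w j log D(U j)`:
(i) `g t (M_w)` is the unique minimizer over `ν ∈ L_m^+` of `∑ j, w j * d_LC(ν, g t (U j))²`;
(ii) `d_LC(g t U₁, g t (M_w)) = α t * d_LC(U₁, M_w)`; (iii) the perfect-fit weight set at time
`t` equals the `t`-independent set `{w : d_LC(U₁, M_w) = 0}`. -/
theorem stmt_9 {m : ℕ} (T J : ℕ)
    (U₁ : Matrix (Fin m) (Fin m) ℝ) (hU₁ : U₁ ∈ LowerPos m)
    (U : Fin J → Matrix (Fin m) (Fin m) ℝ) (hU : ∀ j, U j ∈ LowerPos m)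
    (μ : ℕ → Matrix (Fin m) (Fin m) ℝ) (hμ : ∀ t ∈ Finset.Icc 1 T, μ t ∈ LowerPos m)
    (α : ℕ → ℝ) (hα : ∀ t ∈ Finset.Icc 1 T, α t ∈ Set.Ioo (0 : ℝ) 1)
    (g : ℕ → Matrix (Fin m) (Fin m) ℝ → Matrix (Fin m) (Fin m) ℝ)
    (hgmem : ∀ t ∈ Finset.Icc 1 T, ∀ L ∈ LowerPos m, g t L ∈ LowerPos m)
    (hglower : ∀ t ∈ Finset.Icc 1 T, ∀ L ∈ LowerPos m,
      strictLower (g t L) = strictLower (μ t) + α t • (strictLower L - strictLower (μ t)))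
    (hgdiag : ∀ t ∈ Finset.Icc 1 T, ∀ L ∈ LowerPos m,
      logDiag (g t L) = logDiag (μ t) + α t • (logDiag L - logDiag (μ t)))
    (Mw : (Fin J → ℝ) → Matrix (Fin m) (Fin m) ℝ)
    (hMwmem : ∀ w ∈ stdSimplex ℝ (Fin J), Mw w ∈ LowerPos m)
    (hMwlower : ∀ w ∈ stdSimplex ℝ (Fin J),
      strictLower (Mw w) = ∑ j, w j • strictLower (U j))
    (hMwdiag : ∀ w ∈ stdSimplex ℝ (Fin J),
      logDiag (Mw w) = ∑ j, w j • logDiag (U j)) :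
    (∀ t ∈ Finset.Icc 1 T, ∀ w ∈ stdSimplex ℝ (Fin J),
      ((∀ ν ∈ LowerPos m,
          ∑ j, w j * dLC (g t (Mw w)) (g t (U j)) ^ 2
            ≤ ∑ j, w j * dLC ν (g t (U j)) ^ 2) ∧
        (∀ ν ∈ LowerPos m,
          (∀ ν' ∈ LowerPos m,
            ∑ j, w j * dLC ν (g t (U j)) ^ 2 ≤ ∑ j, w j * dLC ν' (g t (U j)) ^ 2) →
          ν = g t (Mw w))) ∧
      dLC (g t U₁) (g t (Mw w)) = α t * dLC U₁ (Mw w)) ∧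
    (∀ t ∈ Finset.Icc 1 T,
      {w | w ∈ stdSimplex ℝ (Fin J) ∧ dLC (g t U₁) (g t (Mw w)) = 0}
        = {w | w ∈ stdSimplex ℝ (Fin J) ∧ dLC U₁ (Mw w) = 0}) := by
  have hg : ∀ t ∈ Finset.Icc 1 T, ∀ L ∈ LowerPos m, ∀ i k,
      phiLC (g t L) i k = phiLC (μ t) i k + α t * (phiLC L i k - phiLC (μ t) i k) := by
    intro t ht L hL i k
    simp only [phiLC, hglower t ht L hL, hgdiag t ht L hL, Matrix.add_apply, Matrix.smul_apply,
      Matrix.sub_apply, smul_eq_mul]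
    ring
  have hM : ∀ w ∈ stdSimplex ℝ (Fin J), ∀ i k,
      phiLC (Mw w) i k = ∑ j, w j * phiLC (U j) i k := by
    intro w hw i k
    simp only [phiLC, hMwlower w hw, hMwdiag w hw, Matrix.sum_apply, Matrix.smul_apply,
      smul_eq_mul, mul_add, Finset.sum_add_distrib]
  have hii : ∀ t ∈ Finset.Icc 1 T, ∀ w ∈ stdSimplex ℝ (Fin J),
      dLC (g t U₁) (g t (Mw w)) = α t * dLC U₁ (Mw w) := by
    intro t ht w hw
    have hpos := (hα t ht).1
    rw [← sq_eq_sq₀ (dLC_nonneg _ _) (mul_nonneg hpos.le (dLC_nonneg _ _)), mul_pow, dLC_sq,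
      dLC_sq]
    simp only [Finset.mul_sum]
    refine Finset.sum_congr rfl fun i _ => Finset.sum_congr rfl fun k _ => ?_
    rw [hg t ht _ hU₁, hg t ht _ (hMwmem w hw)]
    ring
  refine ⟨fun t ht w hw => ⟨?_, hii t ht w hw⟩, ?_⟩
  · have hC : ∀ i k, phiLC (g t (Mw w)) i k = ∑ j, w j * phiLC (g t (U j)) i k := by
      intro i k
      rw [hg t ht _ (hMwmem w hw), hM w hw]
      have : ∀ j, w j * phiLC (g t (U j)) i k
          = (1 - α t) * phiLC (μ t) i k * w j + α t * (w j * phiLC (U j) i k) := by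
        intro j
        rw [hg t ht _ (hU j)]; ring
      simp only [this, Finset.sum_add_distrib, ← Finset.mul_sum, hw.2]
      ring
    have key := fun N => dLC_variance w hw.2 (fun j => g t (U j)) (g t (Mw w)) N hC
    have hmem := hgmem t ht _ (hMwmem w hw)
    refine ⟨fun ν _ => ?_, fun ν hν hmin => ?_⟩
    · have := key ν
      have := sq_nonneg (dLC ν (g t (Mw w)))
      linarith
    · have h1 := hmin _ hmem
      have h2 := key ν
      exact eq_of_dLC_sq hν hmem (by linarith)
  · intro t ht
    ext w
    simp only [Set.mem_setOf_eq]
    refine and_congr_right fun hw => ?_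
    rw [hii t ht w hw]
    simp [(hα t ht).1.ne']

end
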